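/- arXiv:1701.04365 — 3 statements merged into one kernel-verified Lean document; each statement's English description precedes it below -/
import Mathlib

section
/- There exist constants c_1 > 0, r_0, c_2 > 0 and c_3 > 0 such that the following holds whenever n and r are positive integers with r even and r_0 ≤ r ≤ c_2 n, with s = ⌈c_2 n / r⌉: there exist a probability space carrying a random variable Q with law μ_n, a σ-algebra 𝓕 on that space, an 𝓕-measurable random variable A and a random variable B with Q = A + B, and an event E ∈ 𝓕 with P(E) ≥ 1 − e^{−c_3 n/r}, such that for almost every point of E the conditional distribution of B given 𝓕 lies in the class ℬ_{r,s} (defined with the constant c_1). -/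
open MeasureTheory ProbabilityTheory

/-- Binary convolution of laws on `ℤ` (the law of the sum of independent variables). -/
noncomputable def mconvZ (μ ν : Measure ℤ) : Measure ℤ :=
  μ.bind (fun x => ν.map (fun y => x + y))

/-- `μ n` is the law of `Q_n`, the number of key comparisons used by QuickSort on `n` keys. -/
def IsQuicksortLaw (μ : ℕ → Measure ℤ) : Prop :=
  (∀ n, IsProbabilityMeasure (μ n)) ∧
  μ 0 = Measure.dirac 0 ∧ μ 1 = Measure.dirac 0 ∧
  ∀ n : ℕ, 2 ≤ n →
    μ n = (n : ENNReal)⁻¹ •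
      ∑ u ∈ Finset.Icc 1 n,
        (mconvZ (μ (u - 1)) (μ (n - u))).map (fun x => x + ((n : ℤ) - 1))

/-- Binary convolution of laws on `ℝ`. -/
noncomputable def mconvR (μ ν : Measure ℝ) : Measure ℝ :=
  μ.bind (fun x => ν.map (fun y => x + y))

/-- Convolution of a finite family of laws on `ℝ`. -/
noncomputable def mconvFamR : {s : ℕ} → (Fin s → Measure ℝ) → Measure ℝ
  | 0, _ => Measure.dirac 0
  | (_ + 1), ν => mconvR (ν 0) (mconvFamR (fun i => ν i.succ))

/-- The class `𝒟_r`: laws of real random variables `X` with `E X = 0`, `|X| ≤ 4r` a.s. and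
`Var X ≥ c₁ (r/2)²`. -/
def MemD (c₁ r : ℝ) (ν : Measure ℝ) : Prop :=
  IsProbabilityMeasure ν ∧ (∫ x, x ∂ν) = 0 ∧ (∀ᵐ x ∂ν, |x| ≤ 4 * r) ∧
    c₁ * (r / 2) ^ 2 ≤ variance (fun x => x) ν

/-- The class `ℬ_{r,s}`: laws of sums of `s` independent random variables each with law
in `𝒟_r`, i.e. `s`-fold convolutions of laws from `𝒟_r`. -/
def MemB (c₁ r : ℝ) (s : ℕ) (ν : Measure ℝ) : Prop :=
  ∃ f : Fin s → Measure ℝ, (∀ i, MemD c₁ r (f i)) ∧ ν = mconvFamR f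

open scoped ENNReal Measure
open Finset (range)

/-- Probability measures on `ℤ` supported on two points at distance at most `4r`, whose variance is
at least `c (r/2)²`. -/
def IsTwoPoint (c r : ℝ) (t : Measure ℤ) : Prop :=
  ∃ (p q : ℝ) (x y : ℤ), 0 ≤ p ∧ 0 ≤ q ∧ p + q = 1 ∧ |(x : ℝ) - y| ≤ 4 * r ∧
    c * (r / 2) ^ 2 ≤ p * q * ((x : ℝ) - y) ^ 2 ∧
    t = ENNReal.ofReal p • Measure.dirac x + ENNReal.ofReal q • Measure.dirac y

/-- Shifted convolutions of exactly `k` two-point laws. -/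
inductive IsTwoPointConv (c r : ℝ) : ℕ → Measure ℤ → Prop
  | dirac (a : ℤ) : IsTwoPointConv c r 0 (Measure.dirac a)
  | conv {k : ℕ} {t π : Measure ℤ} : IsTwoPoint c r t → IsTwoPointConv c r k π →
      IsTwoPointConv c r (k + 1) (t ∗ π)

/-- `TwoPointMixture c r ρ g` says that the finite measure `ρ` is a finite nonnegative combination
`∑ w_j π_j` of shifted convolutions `π_j` of `k_j` two-point laws, with `∑ w_j 2^{-k_j} ≤ g`. -/
inductive TwoPointMixture (c r : ℝ) : Measure ℤ → ℝ → Prop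
  | dirac (a : ℤ) : TwoPointMixture c r (Measure.dirac a) 1
  | conv {t ρ : Measure ℤ} {g : ℝ} : IsTwoPoint c r t → TwoPointMixture c r ρ g →
      TwoPointMixture c r (t ∗ ρ) (g / 2)
  | zero : TwoPointMixture c r 0 0
  | add {ρ ρ' : Measure ℤ} {g g' : ℝ} : TwoPointMixture c r ρ g → TwoPointMixture c r ρ' g' →
      TwoPointMixture c r (ρ + ρ') (g + g')
  | smul {ρ : Measure ℤ} {g w : ℝ} : 0 ≤ w → TwoPointMixture c r ρ g →
      TwoPointMixture c r (ENNReal.ofReal w • ρ) (w * g)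
  | mono {ρ : Measure ℤ} {g g' : ℝ} : g ≤ g' → TwoPointMixture c r ρ g → TwoPointMixture c r ρ g'

/-- `LevelMixture c r s ρ ε` says that `ρ` is a finite nonnegative combination of shifted
convolutions of exactly `s` two-point laws, and of probability measures with total weight `ε`. -/
inductive LevelMixture (c r : ℝ) (s : ℕ) : Measure ℤ → ℝ → Prop
  | good {π : Measure ℤ} : IsTwoPointConv c r s π → LevelMixture c r s π 0
  | bad {π : Measure ℤ} : IsProbabilityMeasure π → LevelMixture c r s π 1
  | zero : LevelMixture c r s 0 0
  | add {ρ ρ' : Measure ℤ} {ε ε' : ℝ} : LevelMixture c r s ρ ε → LevelMixture c r s ρ' ε' →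
      LevelMixture c r s (ρ + ρ') (ε + ε')
  | smul {ρ : Measure ℤ} {ε w : ℝ} : 0 ≤ w → LevelMixture c r s ρ ε →
      LevelMixture c r s (ENNReal.ofReal w • ρ) (w * ε)

section Mixtures

variable {c r : ℝ}

lemma IsTwoPoint.isProbabilityMeasure {t : Measure ℤ} (h : IsTwoPoint c r t) :
    IsProbabilityMeasure t := by
  obtain ⟨p, q, x, y, hp, hq, hpq, -, -, rfl⟩ := h
  constructor
  simp [← ENNReal.ofReal_add hp hq, hpq]

lemma IsTwoPointConv.isProbabilityMeasure {k : ℕ} {π : Measure ℤ} (h : IsTwoPointConv c r k π) :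
    IsProbabilityMeasure π := by
  induction h with
  | dirac a => infer_instance
  | conv ht _ ih =>
    have := ht.isProbabilityMeasure
    infer_instance

lemma TwoPointMixture.isFiniteMeasure {ρ : Measure ℤ} {g : ℝ} (h : TwoPointMixture c r ρ g) :
    IsFiniteMeasure ρ := by
  induction h with
  | dirac a => infer_instance
  | conv ht _ ih =>
    have := ht.isProbabilityMeasure
    infer_instance
  | zero => infer_instance
  | add _ _ ih ih' => infer_instance
  | smul _ _ ih => exact Measure.smul_finite _ ENNReal.ofReal_ne_top
  | mono _ _ ih => exact ih

lemma TwoPointMixture.nonneg {ρ : Measure ℤ} {g : ℝ} (h : TwoPointMixture c r ρ g) : 0 ≤ g := by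
  induction h with
  | dirac a => simp
  | conv ht _ ih => positivity
  | zero => simp
  | add _ _ ih ih' => positivity
  | smul hw _ ih => positivity
  | mono h _ ih => exact ih.trans h

lemma conv_smul_right_of_finite (μ ν : Measure ℤ) [SFinite μ] [SFinite ν] (w : ℝ≥0∞)
    [SFinite (w • ν)] : μ ∗ (w • ν) = w • (μ ∗ ν) := by
  rw [Measure.conv_comm, Measure.conv_smul_left, Measure.conv_comm]

lemma conv_left_comm_of_sFinite (μ ν ρ : Measure ℤ) [SFinite μ] [SFinite ν] [SFinite ρ] :
    μ ∗ (ν ∗ ρ) = ν ∗ (μ ∗ ρ) := by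
  rw [← Measure.conv_assoc, Measure.conv_comm μ ν, Measure.conv_assoc]

lemma TwoPointMixture.shift {ρ : Measure ℤ} {g : ℝ} (h : TwoPointMixture c r ρ g) (a : ℤ) :
    TwoPointMixture c r (Measure.dirac a ∗ ρ) g := by
  induction h with
  | dirac b => rw [Measure.dirac_conv_dirac]; exact .dirac _
  | conv ht h ih =>
    have := ht.isProbabilityMeasure
    have := h.isFiniteMeasure
    rw [conv_left_comm_of_sFinite]
    exact .conv ht ih
  | zero => rw [Measure.conv_zero]; exact .zero
  | add h h' ih ih' =>
    have := h.isFiniteMeasure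
    have := h'.isFiniteMeasure
    rw [Measure.conv_add]; exact .add ih ih'
  | smul hw h ih =>
    have := h.isFiniteMeasure
    have := (TwoPointMixture.smul hw h).isFiniteMeasure
    rw [conv_smul_right_of_finite]; exact .smul hw ih
  | mono hg _ ih => exact .mono hg ih

lemma TwoPointMixture.mul {ρ ρ' : Measure ℤ} {g g' : ℝ} (h : TwoPointMixture c r ρ g)
    (h' : TwoPointMixture c r ρ' g') : TwoPointMixture c r (ρ ∗ ρ') (g * g') := by
  have := h'.isFiniteMeasure
  have h0 := h'.nonneg
  induction h with
  | dirac b => rw [one_mul]; exact h'.shift b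
  | @conv t ρ g ht h ih =>
    have := ht.isProbabilityMeasure
    have := h.isFiniteMeasure
    rw [Measure.conv_assoc, div_mul_eq_mul_div]
    exact .conv ht ih
  | zero => rw [Measure.zero_conv, zero_mul]; exact .zero
  | add h1 h2 ih1 ih2 =>
    have := h1.isFiniteMeasure
    have := h2.isFiniteMeasure
    rw [Measure.add_conv, add_mul]; exact .add ih1 ih2
  | smul hw h ih =>
    rw [Measure.conv_smul_left, mul_assoc]; exact .smul hw ih
  | mono hg _ ih => exact .mono (mul_le_mul_of_nonneg_right hg h0) ih

lemma TwoPointMixture.sum {ι : Type*} (S : Finset ι) {ρ : ι → Measure ℤ} {g : ι → ℝ}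
    (h : ∀ i ∈ S, TwoPointMixture c r (ρ i) (g i)) :
    TwoPointMixture c r (∑ i ∈ S, ρ i) (∑ i ∈ S, g i) := by
  classical
  induction S using Finset.induction_on with
  | empty => simpa using .zero
  | insert i S hi ih =>
    rw [Finset.sum_insert hi, Finset.sum_insert hi]
    exact .add (h i (Finset.mem_insert_self i S))
      (ih fun j hj => h j (Finset.mem_insert_of_mem hj))

lemma LevelMixture.isFiniteMeasure {s : ℕ} {ρ : Measure ℤ} {ε : ℝ}
    (h : LevelMixture c r s ρ ε) : IsFiniteMeasure ρ := by
  induction h with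
  | good h => have := h.isProbabilityMeasure; infer_instance
  | bad h => infer_instance
  | zero => infer_instance
  | add _ _ ih ih' => infer_instance
  | smul _ _ ih => exact Measure.smul_finite _ ENNReal.ofReal_ne_top

lemma LevelMixture.conv {s : ℕ} {ρ t : Measure ℤ} {ε : ℝ} (ht : IsTwoPoint c r t)
    (h : LevelMixture c r s ρ ε) : LevelMixture c r (s + 1) (t ∗ ρ) ε := by
  have := ht.isProbabilityMeasure
  induction h with
  | good h => exact .good (.conv ht h)
  | bad h => exact .bad inferInstance
  | zero => rw [Measure.conv_zero]; exact .zero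
  | add h h' ih ih' =>
    have := h.isFiniteMeasure
    have := h'.isFiniteMeasure
    rw [Measure.conv_add]; exact .add ih ih'
  | smul hw h ih =>
    have := h.isFiniteMeasure
    have := (LevelMixture.smul hw h).isFiniteMeasure
    rw [conv_smul_right_of_finite]; exact .smul hw ih

lemma IsTwoPointConv.shift {k : ℕ} {π : Measure ℤ} (h : IsTwoPointConv c r k π) (a : ℤ) :
    IsTwoPointConv c r k (Measure.dirac a ∗ π) := by
  induction h with
  | dirac b => rw [Measure.dirac_conv_dirac]; exact .dirac _
  | conv ht h ih =>
    have := ht.isProbabilityMeasure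
    have := h.isProbabilityMeasure
    rw [conv_left_comm_of_sFinite]
    exact .conv ht ih

lemma LevelMixture.shift {s : ℕ} {ρ : Measure ℤ} {ε : ℝ} (h : LevelMixture c r s ρ ε) (a : ℤ) :
    LevelMixture c r s (Measure.dirac a ∗ ρ) ε := by
  induction h with
  | good h => exact .good (h.shift a)
  | bad h => exact .bad inferInstance
  | zero => rw [Measure.conv_zero]; exact .zero
  | add h h' ih ih' =>
    have := h.isFiniteMeasure
    have := h'.isFiniteMeasure
    rw [Measure.conv_add]; exact .add ih ih'
  | smul hw h ih =>
    have := h.isFiniteMeasure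
    have := (LevelMixture.smul hw h).isFiniteMeasure
    rw [conv_smul_right_of_finite]; exact .smul hw ih

lemma TwoPointMixture.levelMixture_zero {ρ : Measure ℤ} {g : ℝ} (h : TwoPointMixture c r ρ g) :
    LevelMixture c r 0 ρ 0 := by
  induction h with
  | dirac a => exact .good (.dirac a)
  | conv ht h ih =>
    obtain ⟨p, q, x, y, hp, hq, -, -, -, rfl⟩ := ht
    have := h.isFiniteMeasure
    have := Measure.smul_finite (Measure.dirac x) (c := ENNReal.ofReal p) ENNReal.ofReal_ne_top
    have := Measure.smul_finite (Measure.dirac y) (c := ENNReal.ofReal q) ENNReal.ofReal_ne_top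
    rw [Measure.add_conv, Measure.conv_smul_left, Measure.conv_smul_left]
    simpa using LevelMixture.add (.smul hp (ih.shift x)) (.smul hq (ih.shift y))
  | zero => exact .zero
  | add _ _ ih ih' => simpa using ih.add ih'
  | smul hw _ ih => simpa using ih.smul hw
  | mono _ _ ih => exact ih

lemma TwoPointMixture.exists_levelMixture {ρ : Measure ℤ} {g : ℝ} (h : TwoPointMixture c r ρ g)
    (s : ℕ) : ∃ ε ≤ 2 ^ s * g, LevelMixture c r s ρ ε := by
  induction h generalizing s with
  | dirac a =>
    rcases s with _ | s
    · exact ⟨0, by simp, .good (.dirac a)⟩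
    · exact ⟨1, by rw [mul_one]; exact one_le_pow₀ (by norm_num), .bad inferInstance⟩
  | conv ht h ih =>
    rcases s with _ | s
    · refine ⟨0, ?_, (TwoPointMixture.conv ht h).levelMixture_zero⟩
      have := h.nonneg
      positivity
    · obtain ⟨ε, hε, hm⟩ := ih s
      exact ⟨ε, hε.trans_eq (by ring), hm.conv ht⟩
  | zero => exact ⟨0, by simp, .zero⟩
  | add _ _ ih ih' =>
    obtain ⟨ε, hε, hm⟩ := ih s
    obtain ⟨ε', hε', hm'⟩ := ih' s
    exact ⟨ε + ε', by linarith, hm.add hm'⟩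
  | smul hw _ ih =>
    obtain ⟨ε, hε, hm⟩ := ih s
    exact ⟨_, (mul_le_mul_of_nonneg_left hε hw).trans_eq (by ring), hm.smul hw⟩
  | mono hg _ ih =>
    obtain ⟨ε, hε, hm⟩ := ih s
    exact ⟨ε, hε.trans (by gcongr), hm⟩

open Classical in
lemma LevelMixture.exists_fintype {s : ℕ} {ρ : Measure ℤ} {ε : ℝ} (h : LevelMixture c r s ρ ε) :
    ∃ (J : Type) (_ : Fintype J) (w : J → ℝ) (π : J → Measure ℤ) (b : J → Prop),
      (∀ j, 0 ≤ w j) ∧ (∀ j, IsProbabilityMeasure (π j)) ∧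
      (∀ j, ¬ b j → IsTwoPointConv c r s (π j)) ∧
      ρ = ∑ j, ENNReal.ofReal (w j) • π j ∧ ∑ j, (if b j then w j else 0) = ε := by
  induction h with
  | @good π h =>
    exact ⟨Unit, inferInstance, fun _ => 1, fun _ => π, fun _ => False, by simp,
      fun _ => h.isProbabilityMeasure, fun _ _ => h, by simp, by simp⟩
  | @bad π h =>
    exact ⟨Unit, inferInstance, fun _ => 1, fun _ => π, fun _ => True, by simp,
      fun _ => h, by simp, by simp, by simp⟩
  | zero =>
    exact ⟨Empty, inferInstance, fun _ => 1, fun _ => 0, fun _ => True, by simp,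
      by simp, by simp, by simp, by simp⟩
  | add _ _ ih ih' =>
    obtain ⟨J, _, w, π, b, h1, h2, h3, h4, h5⟩ := ih
    obtain ⟨J', _, w', π', b', h1', h2', h3', h4', h5'⟩ := ih'
    refine ⟨J ⊕ J', inferInstance, Sum.elim w w', Sum.elim π π', Sum.elim b b', ?_, ?_, ?_, ?_, ?_⟩
    · rintro (j | j); exacts [h1 j, h1' j]
    · rintro (j | j); exacts [h2 j, h2' j]
    · rintro (j | j); exacts [h3 j, h3' j]
    · simp [Fintype.sum_sum_type, h4, h4']
    · rw [← h5, ← h5', Fintype.sum_sum_type]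
      congr!
  | smul hv _ ih =>
    obtain ⟨J, _, w, π, b, h1, h2, h3, h4, h5⟩ := ih
    refine ⟨J, inferInstance, fun j => _ * w j, π, b, fun j => mul_nonneg hv (h1 j), h2, h3, ?_, ?_⟩
    · simp_rw [h4, Finset.smul_sum, ENNReal.ofReal_mul hv, smul_smul]
    · simp_rw [← h5, Finset.mul_sum, mul_ite, mul_zero]

end Mixtures

section Realization

lemma mconvR_eq_conv (μ ν : Measure ℝ) [SFinite ν] : mconvR μ ν = μ ∗ ν := by
  have h : Measurable fun x : ℝ => ν.map (fun y => x + y) := by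
    simp_rw [← Measure.dirac_conv]
    refine Measure.measurable_of_measurable_coe _ fun t ht => ?_
    simp_rw [Measure.dirac_conv, Measure.map_apply (measurable_const_add _) ht]
    exact measurable_measure_prodMk_left (s := {p : ℝ × ℝ | p.1 + p.2 ∈ t})
      (measurable_add ht)
  refine Measure.ext_of_lintegral _ fun f hf => ?_
  rw [mconvR, Measure.lintegral_bind h.aemeasurable hf.aemeasurable, Measure.lintegral_conv hf]
  exact lintegral_congr fun x => lintegral_map hf (measurable_const_add x)

lemma mconvZ_eq_conv (μ ν : Measure ℤ) [SFinite ν] : mconvZ μ ν = μ ∗ ν := by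
  refine Measure.ext_of_lintegral _ fun f hf => ?_
  rw [mconvZ, Measure.lintegral_bind (measurable_of_countable _).aemeasurable hf.aemeasurable,
    Measure.lintegral_conv hf]
  exact lintegral_congr fun x => lintegral_map hf (measurable_const_add x)

lemma IsTwoPoint.exists_memD {c r : ℝ} {t : Measure ℤ} (h : IsTwoPoint c r t) :
    ∃ a : ℝ, MemD c r (t.map fun x : ℤ => (x : ℝ) - a) := by
  have := h.isProbabilityMeasure
  obtain ⟨p, q, x, y, hp, hq, hpq, hxy, hv, rfl⟩ := h
  have hm : ∀ a : ℝ, Measurable fun x : ℤ => (x : ℝ) - a := fun a => measurable_of_countable _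
  have hint : ∀ f : ℝ → ℝ, Measurable f → ∀ a : ℝ, ∫ u, f u ∂((ENNReal.ofReal p •
      Measure.dirac x + ENNReal.ofReal q • Measure.dirac y).map fun x : ℤ => (x : ℝ) - a) =
      p * f (x - a) + q * f (y - a) := by
    intro f hf a
    rw [integral_map (hm a).aemeasurable hf.aestronglyMeasurable, integral_add_measure,
      integral_smul_measure, integral_smul_measure]
    · simp [ENNReal.toReal_ofReal, hp, hq]
    · exact (integrable_dirac (by simp)).smul_measure ENNReal.ofReal_ne_top
    · exact (integrable_dirac (by simp)).smul_measure ENNReal.ofReal_ne_top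
  have hq' : q = 1 - p := by linarith
  have hmean : ∫ u, u ∂((ENNReal.ofReal p • Measure.dirac x + ENNReal.ofReal q •
      Measure.dirac y).map fun z : ℤ => (z : ℝ) - (p * x + q * y)) = 0 := by
    rw [hint (fun u => u) measurable_id, hq']
    ring
  refine ⟨p * x + q * y, Measure.isProbabilityMeasure_map (hm _).aemeasurable, hmean, ?_, ?_⟩
  · rw [ae_map_iff (hm _).aemeasurable (measurableSet_le (by fun_prop) (by fun_prop)),
      ae_add_measure_iff]
    have hx : |(x : ℝ) - (p * x + q * y)| ≤ 4 * r := by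
      rw [show (x : ℝ) - (p * x + q * y) = q * (x - y) by rw [hq']; ring, abs_mul, abs_of_nonneg hq]
      nlinarith [abs_nonneg ((x : ℝ) - y)]
    have hy : |(y : ℝ) - (p * x + q * y)| ≤ 4 * r := by
      rw [show (y : ℝ) - (p * x + q * y) = -(p * (x - y)) by rw [hq']; ring, abs_neg, abs_mul,
        abs_of_nonneg hp]
      nlinarith [abs_nonneg ((x : ℝ) - y)]
    exact ⟨Measure.ae_smul_measure (by simpa [ae_dirac_eq] using hx) _,
      Measure.ae_smul_measure (by simpa [ae_dirac_eq] using hy) _⟩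
  · rw [variance_eq_integral measurable_id'.aemeasurable, hmean,
      hint (fun u => (u - 0) ^ 2) (by fun_prop)]
    refine hv.trans_eq ?_
    rw [hq']
    ring

lemma IsTwoPointConv.exists_memB {c r : ℝ} {k : ℕ} {π : Measure ℤ} (h : IsTwoPointConv c r k π) :
    ∃ a : ℝ, MemB c r k (π.map fun x : ℤ => (x : ℝ) - a) := by
  induction h with
  | dirac b =>
    refine ⟨b, Fin.elim0, fun i => i.elim0, ?_⟩
    rw [Measure.map_dirac' (measurable_of_countable _)]
    simp [mconvFamR]
  | @conv k t π ht h ih =>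
    have := ht.isProbabilityMeasure
    have := h.isProbabilityMeasure
    obtain ⟨a, ha⟩ := ht.exists_memD
    obtain ⟨b, f, hf, hb⟩ := ih
    refine ⟨a + b, Fin.cons (t.map fun x : ℤ => (x : ℝ) - a) f, ?_, ?_⟩
    · intro i
      refine Fin.cases ?_ (fun j => ?_) i
      · simpa using ha
      · simpa using hf j
    · simp only [mconvFamR, Fin.cons_zero, Fin.cons_succ]
      rw [← hb, mconvR_eq_conv]
      refine Measure.ext_of_lintegral _ fun g hg => ?_
      have hm : ∀ a : ℝ, Measurable fun x : ℤ => (x : ℝ) - a := fun a => measurable_of_countable _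
      rw [lintegral_map hg (hm _), Measure.lintegral_conv (measurable_of_countable _),
        Measure.lintegral_conv hg, lintegral_map (by fun_prop) (hm _)]
      · refine lintegral_congr fun x => ?_
        rw [lintegral_map (by fun_prop) (hm _)]
        refine lintegral_congr fun y => ?_
        congr 1
        push_cast
        ring

lemma exists_realization {c r : ℝ} {s : ℕ} {ν : Measure ℤ} [IsProbabilityMeasure ν] {ε : ℝ}
    (h : LevelMixture c r s ν ε) :
    ∃ (Ω : Type) (mΩ : MeasurableSpace Ω) (P : Measure Ω),
      IsProbabilityMeasure P ∧
      ∃ (F : MeasurableSpace Ω), F ≤ mΩ ∧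
      ∃ (Q : Ω → ℤ) (A B : Ω → ℝ) (E : Set Ω) (κ : Ω → Measure ℝ),
        Measurable[mΩ] Q ∧ @Measure.map Ω ℤ mΩ _ Q P = ν ∧
        Measurable[F] A ∧ Measurable[mΩ] B ∧
        (∀ ω, (Q ω : ℝ) = A ω + B ω) ∧
        MeasurableSet[F] E ∧
        1 - ENNReal.ofReal ε ≤ P E ∧
        (∀ᵐ ω ∂P, IsProbabilityMeasure (κ ω)) ∧
        (∀ t : Set ℝ, MeasurableSet t → Measurable[F] (fun ω => κ ω t)) ∧
        (∀ t : Set ℝ, MeasurableSet t → ∀ G : Set Ω, MeasurableSet[F] G →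
          P (G ∩ B ⁻¹' t) = ∫⁻ ω in G, κ ω t ∂P) ∧
        (∀ᵐ ω ∂P, ω ∈ E → MemB c r s (κ ω)) := by
  classical
  obtain ⟨J, _, w, π, b, hw, hπ, hgood, rfl, rfl⟩ := h.exists_fintype
  have hex : ∀ j, ∃ a : ℝ, ¬ b j → MemB c r s ((π j).map fun x : ℤ => (x : ℝ) - a) := by
    intro j
    by_cases hb : b j
    · exact ⟨0, fun h => absurd hb h⟩
    · obtain ⟨a, ha⟩ := (hgood j hb).exists_memB
      exact ⟨a, fun _ => ha⟩
  choose a ha using hex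
  have hmZ : ∀ j, Measurable fun x : ℤ => (x : ℝ) - a j := fun j => measurable_of_countable _
  have hwsum : ∑ j, ENNReal.ofReal (w j) = 1 := by
    have := measure_univ (μ := ∑ j, ENNReal.ofReal (w j) • π j)
    rw [Measure.finsetSum_apply] at this
    simpa using this
  let mΩ : MeasurableSpace (J × ℤ) := ⊤
  have hpair : ∀ j : J, Measurable fun x : ℤ => (j, x) := fun j => measurable_of_countable _
  let P : Measure (J × ℤ) := ∑ j, ENNReal.ofReal (w j) • (π j).map fun x => (j, x)
  have hP : ∀ S : Set (J × ℤ), P S = ∑ j, ENNReal.ofReal (w j) * π j {x | (j, x) ∈ S} := by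
    intro S
    simp only [P, Measure.finsetSum_apply, Measure.smul_apply, smul_eq_mul]
    refine Finset.sum_congr rfl fun j _ => ?_
    rw [Measure.map_apply (hpair j) trivial]
    rfl
  have hPprob : IsProbabilityMeasure P := ⟨by simp [hP, hwsum]⟩
  refine ⟨J × ℤ, mΩ, P, hPprob, MeasurableSpace.comap Prod.fst ⊤, le_top, Prod.snd,
    fun ω => a ω.1, fun ω => ω.2 - a ω.1, {ω | ¬ b ω.1},
    fun ω => (π ω.1).map fun x : ℤ => (x : ℝ) - a ω.1, measurable_from_top, ?_, ?_,
    measurable_from_top, fun ω => by ring, ⟨{j | ¬ b j}, trivial, rfl⟩, ?_, ?_, ?_, ?_, ?_⟩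
  · ext S hS
    rw [Measure.map_apply measurable_from_top hS, hP]
    simp
  · exact fun S _ => ⟨a ⁻¹' S, trivial, rfl⟩
  · rw [tsub_le_iff_right, ← measure_univ (μ := P), hP, hP, ENNReal.ofReal_sum_of_nonneg,
      ← Finset.sum_add_distrib]
    · refine Finset.sum_le_sum fun j _ => ?_
      by_cases hb : b j <;> simp [hb]
    · intro j _
      split_ifs
      exacts [hw j, le_rfl]
  · exact Filter.Eventually.of_forall fun ω =>
      Measure.isProbabilityMeasure_map (hmZ _).aemeasurable
  · intro t _ S _
    exact ⟨(fun j => (π j).map (fun x : ℤ => (x : ℝ) - a j) t) ⁻¹' S, trivial, rfl⟩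
  · rintro t ht _ ⟨G, -, rfl⟩
    rw [← lintegral_indicator (by trivial), hP, lintegral_finsetSum_measure]
    refine Finset.sum_congr rfl fun j _ => ?_
    rw [lintegral_smul_measure, lintegral_map measurable_from_top (hpair j), smul_eq_mul]
    congr 1
    by_cases hj : j ∈ G
    · simp [hj, Measure.map_apply (hmZ j) ht]
      rfl
    · simp [hj]
  · exact Filter.Eventually.of_forall fun ω hω => ha _ hω

end Realization

section QuickSort

variable {c r : ℝ} {μ : ℕ → Measure ℤ}

/-- The law of the number of comparisons for sorting `k` keys, given that the first pivot
leaves sublists with `i` and `k - 1 - i` keys. -/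
noncomputable def splitLaw (μ : ℕ → Measure ℤ) (k i : ℕ) : Measure ℤ :=
  Measure.dirac ((k : ℤ) - 1) ∗ (μ i ∗ μ (k - 1 - i))

lemma IsQuicksortLaw.eq_sum_splitLaw (hμ : IsQuicksortLaw μ) {k : ℕ} (hk : 2 ≤ k) :
    μ k = ENNReal.ofReal (1 / k) • ∑ i ∈ range k, splitLaw μ k i := by
  have hprob := hμ.1
  have hk0 : (0 : ℝ) < k := by
    norm_cast
    omega
  rw [hμ.2.2.2 k hk, one_div, ENNReal.ofReal_inv_of_pos hk0, ENNReal.ofReal_natCast]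
  congr 1
  refine Finset.sum_nbij' (fun u => u - 1) (fun i => i + 1) ?_ ?_ ?_ ?_ ?_
  · intro u hu
    simp only [Finset.mem_Icc, Finset.mem_range] at *
    omega
  · intro u hu
    simp only [Finset.mem_Icc, Finset.mem_range] at *
    omega
  · intro u hu
    simp only [Finset.mem_Icc] at *
    omega
  · intro u hu
    simp
  · intro u hu
    simp only [Finset.mem_Icc] at hu
    rw [mconvZ_eq_conv, ← Measure.conv_dirac, Measure.conv_comm, splitLaw,
      show k - 1 - (u - 1) = k - u by omega]

lemma TwoPointMixture.splitLaw {k i : ℕ} {g g' : ℝ} (h : TwoPointMixture c r (μ i) g)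
    (h' : TwoPointMixture c r (μ (k - 1 - i)) g') :
    TwoPointMixture c r (splitLaw μ k i) (g * g') :=
  (h.mul h').shift _

lemma IsQuicksortLaw.twoPointMixture_of_splitLaw (hμ : IsQuicksortLaw μ) {k : ℕ} (hk : 2 ≤ k)
    {g : ℕ → ℝ} (h : ∀ i < k, TwoPointMixture c r (splitLaw μ k i) (g i)) :
    TwoPointMixture c r (μ k) ((∑ i ∈ range k, g i) / k) := by
  rw [hμ.eq_sum_splitLaw hk]
  exact .mono (le_of_eq (by ring)) (.smul (by positivity)
    (.sum _ fun i hi => h i (Finset.mem_range.1 hi)))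

lemma IsQuicksortLaw.twoPointMixture_one (hμ : IsQuicksortLaw μ) (k : ℕ) :
    TwoPointMixture c r (μ k) 1 := by
  induction k using Nat.strong_induction_on with
  | _ k ih =>
    rcases Nat.lt_or_ge k 2 with hk | hk
    · interval_cases k
      · rw [hμ.2.1]; exact .dirac 0
      · rw [hμ.2.2.1]; exact .dirac 0
    · refine .mono (le_of_eq ?_) (hμ.twoPointMixture_of_splitLaw hk (g := fun _ => 1 * 1)
        fun i hi => (ih i hi).splitLaw (ih _ (by omega)))
      have : (0 : ℝ) < k := by
        norm_cast
        omega
      simp [this.ne']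

lemma conv_finset_sum {ι : Type*} (S : Finset ι) (ρ : Measure ℤ) [IsFiniteMeasure ρ]
    (ν : ι → Measure ℤ) [∀ i, IsFiniteMeasure (ν i)] :
    ρ ∗ (∑ i ∈ S, ν i) = ∑ i ∈ S, ρ ∗ ν i := by
  classical
  induction S using Finset.induction_on with
  | empty => simp
  | insert i S hi ih =>
    rw [Finset.sum_insert hi, Finset.sum_insert hi, Measure.conv_add, ih]

/-- Two weighted point masses with comparable weights combine into a multiple of a two-point law. -/
lemma TwoPointMixture.add_shift {ρ : Measure ℤ} {g α β : ℝ} {x y : ℤ}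
    (h : TwoPointMixture c r ρ g) (hα : 0 < α) (hβ : 0 < β) (hxy : |(x : ℝ) - y| ≤ 4 * r)
    (hv : c * (r / 2) ^ 2 * (α + β) ^ 2 ≤ α * β * ((x : ℝ) - y) ^ 2) :
    TwoPointMixture c r (ENNReal.ofReal α • (Measure.dirac x ∗ ρ) +
      ENNReal.ofReal β • (Measure.dirac y ∗ ρ)) ((α + β) * (g / 2)) := by
  have hs : 0 < α + β := by positivity
  have := h.isFiniteMeasure
  have ht : IsTwoPoint c r (ENNReal.ofReal (α / (α + β)) • Measure.dirac x +
      ENNReal.ofReal (β / (α + β)) • Measure.dirac y) := by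
    refine ⟨α / (α + β), β / (α + β), x, y, by positivity, by positivity, by field_simp, hxy,
      ?_, rfl⟩
    rw [div_mul_div_comm, div_mul_eq_mul_div, le_div_iff₀ (by positivity), ← sq]
    exact hv
  convert TwoPointMixture.smul hs.le (.conv ht h) using 1
  have := Measure.smul_finite (Measure.dirac x) (c := ENNReal.ofReal (α / (α + β)))
    ENNReal.ofReal_ne_top
  have := Measure.smul_finite (Measure.dirac y) (c := ENNReal.ofReal (β / (α + β)))
    ENNReal.ofReal_ne_top
  rw [Measure.add_conv, Measure.conv_smul_left, Measure.conv_smul_left, smul_add, smul_smul,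
    smul_smul, ← ENNReal.ofReal_mul hs.le, ← ENNReal.ofReal_mul hs.le, mul_div_cancel₀ _ hs.ne',
    mul_div_cancel₀ _ hs.ne']

/-- Expanding a second pivot, chosen in one of the two sublists, over a set `S` of its outcomes. -/
lemma IsQuicksortLaw.exists_splitLaw_eq (hμ : IsQuicksortLaw μ) {m i : ℕ} {S : Finset ℕ}
    (hk : 2 ≤ m - 1 - i) (hS : S ⊆ range (m - 1 - i)) :
    ∃ R, TwoPointMixture c r R (1 - S.card * (1 / (m - 1 - i : ℕ))) ∧
      splitLaw μ m i = ∑ j ∈ S, ENNReal.ofReal (1 / (m - 1 - i : ℕ)) •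
        (Measure.dirac ((m : ℤ) - 1 + (((m - 1 - i : ℕ) : ℤ) - 1)) ∗
          (μ i ∗ (μ j ∗ μ (m - 1 - i - 1 - j)))) + R := by
  have hprob := hμ.1
  have hfin' : ∀ j, IsFiniteMeasure (splitLaw μ (m - 1 - i) j) :=
    fun j => by unfold splitLaw; infer_instance
  have key : splitLaw μ m i = ENNReal.ofReal (1 / (m - 1 - i : ℕ)) •
      ∑ j ∈ range (m - 1 - i), Measure.dirac ((m : ℤ) - 1) ∗
        (μ i ∗ splitLaw μ (m - 1 - i) j) := by
    conv_lhs => rw [splitLaw, hμ.eq_sum_splitLaw hk]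
    rw [← Measure.conv_assoc, Measure.conv_comm, Measure.conv_smul_left, Measure.conv_comm,
      conv_finset_sum]
    simp_rw [Measure.conv_assoc]
  refine ⟨ENNReal.ofReal (1 / (m - 1 - i : ℕ)) • ∑ j ∈ range (m - 1 - i) \ S,
    Measure.dirac ((m : ℤ) - 1) ∗ (μ i ∗ splitLaw μ (m - 1 - i) j), ?_, ?_⟩
  · refine .mono (le_of_eq ?_) (.smul (by positivity) (.sum (g := fun _ => 1 * (1 * 1)) _ fun j _ =>
      ((hμ.twoPointMixture_one i).mul
        ((hμ.twoPointMixture_one j).splitLaw (hμ.twoPointMixture_one _))).shift _))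
    rw [Finset.sum_const, Finset.card_sdiff_of_subset hS, Finset.card_range, nsmul_eq_mul]
    have hcard := Finset.card_le_card hS
    rw [Finset.card_range] at hcard
    generalize m - 1 - i = k at hk hcard ⊢
    have : (0 : ℝ) < k := by
      norm_cast
      omega
    rw [Nat.cast_sub hcard]
    field_simp
  · rw [key, ← Finset.sum_sdiff hS, add_comm, smul_add, Finset.smul_sum]
    congr 1
    refine Finset.sum_congr rfl fun j _ => ?_
    rw [splitLaw, conv_left_comm_of_sFinite (μ i), ← Measure.conv_assoc,
      Measure.dirac_conv_dirac]

/-- Two pivots leaving an outer sublist of `i` keys and an outer sublist of `j` keys may be chosen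
in either order; this yields a two-point law. -/
lemma IsQuicksortLaw.twoPointMixture_of_mem_Icc (hμ : IsQuicksortLaw μ) {R m : ℕ} (hR : 8 ≤ R)
    (hRm : R ≤ m) (hm : m ≤ 2 * R) :
    TwoPointMixture (1 / 1000) R (μ m) (255 / 256) := by
  have hprob := hμ.1
  set h := m / 8 with hh
  have h1 : 1 ≤ h := by omega
  have h8 : 8 * h ≤ m := by omega
  have h16 : m ≤ 16 * h := by omega
  have e₁ : ∀ i, ∃ ρ, i ∈ range h →
      TwoPointMixture (1 / 1000) R ρ
        (1 - (Finset.Ico (4 * h) (5 * h)).card * (1 / (m - 1 - i : ℕ))) ∧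
      splitLaw μ m i = ∑ j ∈ Finset.Ico (4 * h) (5 * h), ENNReal.ofReal (1 / (m - 1 - i : ℕ)) •
        (Measure.dirac ((m : ℤ) - 1 + (((m - 1 - i : ℕ) : ℤ) - 1)) ∗
          (μ i ∗ (μ j ∗ μ (m - 1 - i - 1 - j)))) + ρ := by
    intro i
    by_cases hi : i ∈ range h
    · have hi' := Finset.mem_range.1 hi
      obtain ⟨ρ, hρ⟩ := hμ.exists_splitLaw_eq (c := 1 / 1000) (r := R) (m := m) (i := i)
        (S := Finset.Ico (4 * h) (5 * h)) (by omega) (by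
          intro j hj
          simp only [Finset.mem_Ico, Finset.mem_range] at *
          omega)
      exact ⟨ρ, fun _ => hρ⟩
    · exact ⟨0, fun h => absurd h hi⟩
  have e₂ : ∀ j, ∃ ρ, j ∈ Finset.Ico (4 * h) (5 * h) →
      TwoPointMixture (1 / 1000) R ρ (1 - (range h).card * (1 / (m - 1 - j : ℕ))) ∧
      splitLaw μ m j = ∑ i ∈ range h, ENNReal.ofReal (1 / (m - 1 - j : ℕ)) •
        (Measure.dirac ((m : ℤ) - 1 + (((m - 1 - j : ℕ) : ℤ) - 1)) ∗
          (μ j ∗ (μ i ∗ μ (m - 1 - j - 1 - i)))) + ρ := by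
    intro j
    by_cases hj : j ∈ Finset.Ico (4 * h) (5 * h)
    · have hj' := Finset.mem_Ico.1 hj
      obtain ⟨ρ, hρ⟩ := hμ.exists_splitLaw_eq (c := 1 / 1000) (r := R) (m := m) (i := j)
        (S := range h) (by omega) (by
          intro i hi
          simp only [Finset.mem_range] at *
          omega)
      exact ⟨ρ, fun _ => hρ⟩
    · exact ⟨0, fun h => absurd h hj⟩
  choose ρ₁ hρ₁ using e₁
  choose ρ₂ hρ₂ using e₂
  have hsub : range h ⊆ range m := Finset.range_subset_range.2 (by omega)
  have hsub' : Finset.Ico (4 * h) (5 * h) ⊆ range m \ range h := by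
    intro j hj
    simp only [Finset.mem_Ico, Finset.mem_range, Finset.mem_sdiff] at *
    omega
  have hpair : ∀ i ∈ range h, ∀ j ∈ Finset.Ico (4 * h) (5 * h), TwoPointMixture (1 / 1000) R
      (ENNReal.ofReal (1 / (m - 1 - i : ℕ)) •
        (Measure.dirac ((m : ℤ) - 1 + (((m - 1 - i : ℕ) : ℤ) - 1)) ∗
          (μ i ∗ (μ j ∗ μ (m - 1 - i - 1 - j)))) +
      ENNReal.ofReal (1 / (m - 1 - j : ℕ)) •
        (Measure.dirac ((m : ℤ) - 1 + (((m - 1 - j : ℕ) : ℤ) - 1)) ∗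
          (μ j ∗ (μ i ∗ μ (m - 1 - j - 1 - i)))))
      ((1 / (m - 1 - i : ℕ) + 1 / (m - 1 - j : ℕ)) * ((1 * (1 * 1)) / 2)) := by
    intro i hi j hj
    simp only [Finset.mem_range, Finset.mem_Ico] at hi hj
    rw [conv_left_comm_of_sFinite (μ j), show m - 1 - j - 1 - i = m - 1 - i - 1 - j by omega]
    have hp : m - 1 - i + i + 1 = m := by omega
    have hq : m - 1 - j + j + 1 = m := by omega
    generalize m - 1 - i = p at hp ⊢
    generalize m - 1 - j = q at hq ⊢
    have hp7 : 7 * h ≤ p := by omega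
    have hq3 : 3 * h ≤ q := by omega
    have hpq : p + q ≤ 32 * h := by omega
    have hd : 3 * h + q ≤ p := by omega
    have hd' : p ≤ q + 2 * R := by omega
    have hRh : R ≤ 16 * h := by omega
    have hp0 : 0 < p := by omega
    have hq0 : 0 < q := by omega
    clear_value h
    have h1' : (1 : ℝ) ≤ h := by exact_mod_cast h1
    have hp7' : (7 : ℝ) * h ≤ p := by exact_mod_cast hp7
    have hq3' : (3 : ℝ) * h ≤ q := by exact_mod_cast hq3
    have hpq' : (p : ℝ) + q ≤ 32 * h := by exact_mod_cast hpq
    have hd1 : (3 : ℝ) * h + q ≤ p := by exact_mod_cast hd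
    have hd2 : (p : ℝ) ≤ q + 2 * R := by exact_mod_cast hd'
    have hRh' : (R : ℝ) ≤ 16 * h := by exact_mod_cast hRh
    have hp0' : (0 : ℝ) < p := by exact_mod_cast hp0
    have hq0' : (0 : ℝ) < q := by exact_mod_cast hq0
    have hxy : (((m : ℤ) - 1 + ((p : ℤ) - 1) : ℤ) : ℝ) - (((m : ℤ) - 1 + ((q : ℤ) - 1) : ℤ) : ℝ) =
      p - q := by push_cast; ring
    refine TwoPointMixture.add_shift ((hμ.twoPointMixture_one i).mul
      ((hμ.twoPointMixture_one j).mul (hμ.twoPointMixture_one _))) (by positivity) (by positivity)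
      ?_ ?_
    · rw [hxy, abs_le]
      constructor <;> linarith
    · rw [hxy]
      have b1 : ((R : ℝ) / 2) ^ 2 ≤ (8 * h) ^ 2 := by gcongr; linarith
      have b2 : ((p : ℝ) + q) ^ 2 ≤ (32 * h) ^ 2 := by gcongr
      have b3 : (3 * (h : ℝ)) ^ 2 ≤ (p - q) ^ 2 := by
        have : 3 * (h : ℝ) ≤ p - q := by linarith
        gcongr
      have b4 : (7 * (h : ℝ)) * (3 * h) ≤ p * q := by gcongr
      have b5 : ((R : ℝ) / 2) ^ 2 * (p + q) ^ 2 ≤ (8 * h) ^ 2 * (32 * h) ^ 2 := by gcongr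
      have b6 : (7 * (h : ℝ)) * (3 * h) * (3 * (h : ℝ)) ^ 2 ≤ p * q * (p - q) ^ 2 := by gcongr
      have b7 : 1 / 1000 * ((R : ℝ) / 2) ^ 2 * (p + q) ^ 2 ≤ p * q * (p - q) ^ 2 := by
        nlinarith [pow_pos (zero_lt_one.trans_le h1') 4]
      calc 1 / 1000 * ((R : ℝ) / 2) ^ 2 * (1 / (p : ℝ) + 1 / q) ^ 2
          = (1 / 1000 * ((R : ℝ) / 2) ^ 2 * (p + q) ^ 2) / ((p : ℝ) * q) ^ 2 := by
            field_simp
            ring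
        _ ≤ ((p : ℝ) * q * (p - q) ^ 2) / ((p : ℝ) * q) ^ 2 := by gcongr
        _ = 1 / (p : ℝ) * (1 / q) * (p - q) ^ 2 := by field_simp
  have hsum : ∑ i ∈ range m, splitLaw μ m i =
      ∑ i ∈ range h, ∑ j ∈ Finset.Ico (4 * h) (5 * h), (ENNReal.ofReal (1 / (m - 1 - i : ℕ)) •
        (Measure.dirac ((m : ℤ) - 1 + (((m - 1 - i : ℕ) : ℤ) - 1)) ∗
          (μ i ∗ (μ j ∗ μ (m - 1 - i - 1 - j)))) +
      ENNReal.ofReal (1 / (m - 1 - j : ℕ)) •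
        (Measure.dirac ((m : ℤ) - 1 + (((m - 1 - j : ℕ) : ℤ) - 1)) ∗
          (μ j ∗ (μ i ∗ μ (m - 1 - j - 1 - i))))) +
      (∑ i ∈ range h, ρ₁ i + (∑ j ∈ Finset.Ico (4 * h) (5 * h), ρ₂ j +
        ∑ i ∈ (range m \ range h) \ Finset.Ico (4 * h) (5 * h), splitLaw μ m i)) := by
    rw [← Finset.sum_sdiff hsub, ← Finset.sum_sdiff hsub',
      Finset.sum_congr rfl fun i hi => (hρ₁ i hi).2, Finset.sum_congr rfl fun j hj => (hρ₂ j hj).2]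
    simp_rw [Finset.sum_add_distrib]
    rw [Finset.sum_comm (s := Finset.Ico (4 * h) (5 * h))]
    abel
  rw [hμ.eq_sum_splitLaw (by omega), hsum]
  refine .mono ?_ (.smul (by positivity) (.add (.sum _ fun i hi => .sum _ fun j hj => hpair i hi j hj)
    (.add (.sum _ fun i hi => (hρ₁ i hi).1) (.add (.sum _ fun j hj => (hρ₂ j hj).1)
      (.sum (g := fun _ => 1 * 1) _ fun i _ =>
        (hμ.twoPointMixture_one i).splitLaw (hμ.twoPointMixture_one _))))))
  have hm0 : (0 : ℝ) < m := by
    norm_cast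
    omega
  have hα : (h : ℝ) * (1 / m) ≤ ∑ i ∈ range h, 1 / ((m - 1 - i : ℕ) : ℝ) := by
    rw [← nsmul_eq_mul]
    refine (Finset.card_nsmul_le_sum (range h) _ (1 / (m : ℝ)) fun i hi => ?_).trans' (by simp)
    have := Finset.mem_range.1 hi
    have h0 : 0 < m - 1 - i := by omega
    gcongr
    omega
  have hβ : (h : ℝ) * (1 / m) ≤ ∑ j ∈ Finset.Ico (4 * h) (5 * h), 1 / ((m - 1 - j : ℕ) : ℝ) := by
    rw [← nsmul_eq_mul]
    refine (Finset.card_nsmul_le_sum (Finset.Ico (4 * h) (5 * h)) _ (1 / (m : ℝ))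
      fun j hj => ?_).trans' (le_of_eq ?_)
    · have := Finset.mem_Ico.1 hj
      have h0 : 0 < m - 1 - j := by omega
      gcongr
      omega
    · rw [Nat.card_Ico, show 5 * h - 4 * h = h by omega]
  have hcard : (((range m \ range h) \ Finset.Ico (4 * h) (5 * h)).card : ℝ) = m - 2 * h := by
    rw [Finset.card_sdiff_of_subset hsub', Finset.card_sdiff_of_subset hsub, Finset.card_range,
      Finset.card_range, Nat.card_Ico, show m - h - (5 * h - 4 * h) = m - 2 * h by omega,
      Nat.cast_sub (by omega)]
    push_cast
    ring
  have hcard' : ((Finset.Ico (4 * h) (5 * h)).card : ℝ) = h := by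
    rw [Nat.card_Ico, show 5 * h - 4 * h = h by omega]
  simp_rw [← Finset.sum_mul, Finset.sum_add_distrib, Finset.sum_sub_distrib, Finset.sum_const,
    nsmul_eq_mul, ← Finset.mul_sum, hcard, hcard', Finset.card_range]
  set α := ∑ i ∈ range h, 1 / ((m - 1 - i : ℕ) : ℝ)
  set β := ∑ j ∈ Finset.Ico (4 * h) (5 * h), 1 / ((m - 1 - j : ℕ) : ℝ)
  have h16' : (m : ℝ) ≤ 16 * h := by exact_mod_cast h16
  have hh0 : (0 : ℝ) ≤ h := h.cast_nonneg
  have hfin : 1 / (m : ℝ) * (m - h * (h * (1 / m))) ≤ 255 / 256 := by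
    have e : 1 / (m : ℝ) * (m - h * (h * (1 / m))) = 1 - (h / m) ^ 2 := by field_simp
    have : (1 : ℝ) / 16 ≤ h / m := by
      rw [div_le_div_iff₀ (by norm_num) hm0]
      linarith
    rw [e]
    nlinarith
  refine le_trans ?_ hfin
  gcongr
  nlinarith

lemma IsQuicksortLaw.twoPointMixture_of_le (hμ : IsQuicksortLaw μ) {R m : ℕ} (hR : 8 ≤ R)
    (hRm : R ≤ m) : TwoPointMixture (1 / 1000) R (μ m) (255 / 256) := by
  induction m using Nat.strong_induction_on with
  | _ m ih =>
    rcases Nat.lt_or_ge (2 * R) m with hm | hm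
    · refine .mono (le_of_eq ?_) (hμ.twoPointMixture_of_splitLaw (by omega)
        (g := fun _ => 255 / 256) fun i hi => ?_)
      · have : (0 : ℝ) < m := by
          norm_cast
          omega
        simp [this.ne']
      · rcases Nat.lt_or_ge i R with h | h
        · exact .mono (by norm_num) ((hμ.twoPointMixture_one i).splitLaw
            (ih (m - 1 - i) (by omega) (by omega)))
        · exact .mono (by norm_num) ((ih i hi h).splitLaw (hμ.twoPointMixture_one _))
    · exact hμ.twoPointMixture_of_mem_Icc hR hRm hm

lemma sum_exp_boundary_le {R m : ℕ} (hm : 20000 * R < m) :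
    (∑ i ∈ range m, (Real.exp (1 / 10 ^ 7 - 1 / 1024) +
      ((if i < R then 1 else 0) + (if m ≤ i + R then 1 else 0)) * Real.exp (1 / 10 ^ 7))) ≤ m := by
  have h1 : (range m).filter (fun i => i < R) ⊆ range R := fun i hi => by
    simp only [Finset.mem_filter, Finset.mem_range] at *
    omega
  have h2 : (range m).filter (fun i => m ≤ i + R) ⊆ Finset.Ico (m - R) m := fun i hi => by
    simp only [Finset.mem_filter, Finset.mem_range, Finset.mem_Ico] at *
    omega
  have c1 : (((range m).filter (fun i => i < R)).card : ℝ) ≤ R := by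
    exact_mod_cast (Finset.card_le_card h1).trans_eq (Finset.card_range R)
  have c2 : (((range m).filter (fun i => m ≤ i + R)).card : ℝ) ≤ R := by
    have := Finset.card_le_card h2
    rw [Nat.card_Ico] at this
    exact_mod_cast this.trans (by omega)
  rw [Finset.sum_add_distrib, ← Finset.sum_mul, Finset.sum_add_distrib, Finset.sum_boole,
    Finset.sum_boole, Finset.sum_const, Finset.card_range, nsmul_eq_mul]
  have e1 : Real.exp (1 / 10 ^ 7 - 1 / 1024) ≤ 2048 / 2049 := by
    have h : Real.exp (1 / 10 ^ 7 - 1 / 1024) ≤ Real.exp (-(1 / 2048)) := by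
      gcongr
      norm_num
    refine h.trans ?_
    rw [Real.exp_neg, inv_le_comm₀ (Real.exp_pos _) (by norm_num)]
    refine le_trans (by norm_num) (Real.add_one_le_exp _)
  have e2 : Real.exp (1 / 10 ^ 7) ≤ 3 := by
    have h : Real.exp (1 / 10 ^ 7) ≤ Real.exp 1 := by
      gcongr
      norm_num
    exact h.trans (by linarith [Real.exp_one_lt_d9])
  have hm' : (20000 : ℝ) * R ≤ m := by exact_mod_cast hm.le
  have hm0 : (0 : ℝ) ≤ m := m.cast_nonneg
  have hR0 : (0 : ℝ) ≤ R := R.cast_nonneg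
  calc _ ≤ (m : ℝ) * (2048 / 2049) + (R + R) * 3 := by gcongr
    _ ≤ m := by linarith

lemma IsQuicksortLaw.twoPointMixture_exp (hμ : IsQuicksortLaw μ) {R m : ℕ} (hR : 8 ≤ R)
    (hRm : R ≤ m) :
    TwoPointMixture (1 / 1000) R (μ m) (Real.exp (-(1 / 10 ^ 7 * (m / R)) - 1 / 1024)) := by
  have hR0 : (0 : ℝ) < R := by
    norm_cast
    omega
  have hR1 : (1 : ℝ) / R ≤ 1 := by
    rw [div_le_one hR0]
    norm_cast
    omega
  induction m using Nat.strong_induction_on with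
  | _ m ih =>
    rcases Nat.lt_or_ge (20000 * R) m with hm | hm
    · have hm0 : (0 : ℝ) < m := by
        norm_cast
        omega
      refine .mono ?_ (hμ.twoPointMixture_of_splitLaw (by omega)
        (g := fun i => Real.exp (-(1 / 10 ^ 7 * (m / R)) - 1 / 1024) *
          (Real.exp (1 / 10 ^ 7 - 1 / 1024) +
          ((if i < R then 1 else 0) + (if m ≤ i + R then 1 else 0)) * Real.exp (1 / 10 ^ 7)))
        fun i hi => ?_)
      · rw [← Finset.mul_sum, mul_div_assoc]
        refine mul_le_of_le_one_right (Real.exp_pos _).le ?_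
        rw [div_le_one hm0]
        exact sum_exp_boundary_le hm
      · have hcast : ((m - 1 - i : ℕ) : ℝ) = m - 1 - i := by
          rw [Nat.cast_sub (by omega), Nat.cast_sub (by omega), Nat.cast_one]
        have hpos := Real.exp_pos (1 / 10 ^ 7 - 1 / 1024 : ℝ)
        have hpos' := Real.exp_pos (1 / 10 ^ 7 : ℝ)
        rcases Nat.lt_or_ge i R with h | h
        · refine .mono ?_ ((hμ.twoPointMixture_one i).splitLaw
            (ih (m - 1 - i) (by omega) (by omega)))
          rw [if_pos h, if_neg (by omega), one_mul, hcast]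
          have hi1 : ((i : ℝ) + 1) / R ≤ 1 := by
            rw [div_le_one hR0]
            exact_mod_cast h
          calc _ ≤ Real.exp (-(1 / 10 ^ 7 * (m / R)) - 1 / 1024) * Real.exp (1 / 10 ^ 7) := by
                rw [← Real.exp_add]
                gcongr
                rw [show ((m : ℝ) - 1 - i) / R = m / R - (i + 1) / R by ring]
                linarith
            _ ≤ _ := by
                gcongr
                linarith
        rcases Nat.lt_or_ge (i + R) m with h' | h'
        · refine .mono ?_ ((ih i hi h).splitLaw (ih (m - 1 - i) (by omega) (by omega)))
          rw [if_neg (by omega), if_neg (by omega), add_zero, zero_mul, add_zero, hcast,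
            ← Real.exp_add, ← Real.exp_add]
          refine Real.exp_le_exp.2 ?_
          rw [show ((m : ℝ) - 1 - i) / R = m / R - 1 / R - i / R by ring]
          linarith
        · refine .mono ?_ ((ih i hi h).splitLaw (hμ.twoPointMixture_one _))
          rw [if_neg (by omega), if_pos h', mul_one]
          have hi1 : (m : ℝ) / R - i / R ≤ 1 := by
            rw [← sub_div, div_le_one hR0, sub_le_iff_le_add']
            exact_mod_cast h'
          calc _ ≤ Real.exp (-(1 / 10 ^ 7 * (m / R)) - 1 / 1024) * Real.exp (1 / 10 ^ 7) := by
                rw [← Real.exp_add]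
                gcongr
                linarith
            _ ≤ _ := by
                gcongr
                linarith
    · refine .mono ?_ (hμ.twoPointMixture_of_le hR hRm)
      have hmR : (m : ℝ) / R ≤ 20000 := by
        rw [div_le_iff₀ hR0]
        exact_mod_cast hm
      have : Real.exp (-(1 / 256)) ≤ Real.exp (-(1 / 10 ^ 7 * ((m : ℝ) / R)) - 1 / 1024) := by
        gcongr
        linarith
      refine le_trans ?_ this
      linarith [Real.add_one_le_exp (-(1 / 256) : ℝ)]

end QuickSort

/-- **Decomposition of QuickSort with binomial-like smooth part.**  There are constants
`c₁ > 0`, `r₀`, `c₂ > 0`, `c₃ > 0` such that for positive integers `n`, `r` with `r` even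
and `r₀ ≤ r ≤ c₂ n`, and `s = ⌈c₂ n / r⌉`, one may write `Q_n = A + B` with `A`
measurable w.r.t. a σ-algebra `𝓕` and, on an `𝓕`-measurable event of probability at least
`1 - e^{-c₃ n/r}`, the conditional distribution of `B` given `𝓕` lies in `ℬ_{r,s}`. -/
theorem quicksort_decomposition_binomial_like
    (μ : ℕ → Measure ℤ) (hμ : IsQuicksortLaw μ) :
    ∃ c₁ : ℝ, 0 < c₁ ∧ ∃ r₀ : ℝ, ∃ c₂ : ℝ, 0 < c₂ ∧ ∃ c₃ : ℝ, 0 < c₃ ∧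
    ∀ n r : ℕ, 0 < n → 0 < r → Even r → r₀ ≤ (r : ℝ) → (r : ℝ) ≤ c₂ * n →
    ∀ s : ℕ, s = ⌈c₂ * (n : ℝ) / (r : ℝ)⌉₊ →
    ∃ (Ω : Type) (mΩ : MeasurableSpace Ω) (P : Measure Ω),
      IsProbabilityMeasure P ∧
      ∃ (F : MeasurableSpace Ω), F ≤ mΩ ∧
      ∃ (Q : Ω → ℤ) (A B : Ω → ℝ) (E : Set Ω) (κ : Ω → Measure ℝ),
        Measurable[mΩ] Q ∧ @Measure.map Ω ℤ mΩ _ Q P = μ n ∧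
        Measurable[F] A ∧ Measurable[mΩ] B ∧
        (∀ ω, (Q ω : ℝ) = A ω + B ω) ∧
        MeasurableSet[F] E ∧
        1 - ENNReal.ofReal (Real.exp (-c₃ * (n : ℝ) / (r : ℝ))) ≤ P E ∧
        -- `κ` is the conditional distribution (regular conditional probability
        -- distribution) of `B` given `F`:
        (∀ᵐ ω ∂P, IsProbabilityMeasure (κ ω)) ∧
        (∀ t : Set ℝ, MeasurableSet t → Measurable[F] (fun ω => κ ω t)) ∧
        (∀ t : Set ℝ, MeasurableSet t → ∀ G : Set Ω, MeasurableSet[F] G →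
          P (G ∩ B ⁻¹' t) = ∫⁻ ω in G, κ ω t ∂P) ∧
        -- on almost every point of `E` it lies in the class `ℬ_{r,s}`:
        (∀ᵐ ω ∂P, ω ∈ E → MemB c₁ (r : ℝ) s (κ ω)) := by
  have hprob := hμ.1
  refine ⟨1 / 1000, by norm_num, 8, 1 / 10 ^ 7 / 4, by norm_num, 1 / 10 ^ 7 / 2, by norm_num, ?_⟩
  rintro n r - hr - hr₀ hrn s rfl
  have hr0 : (0 : ℝ) < r := by exact_mod_cast hr
  have hn0 : (0 : ℝ) ≤ n := n.cast_nonneg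
  have hrn' : r ≤ n := by
    have : (r : ℝ) ≤ n := by linarith
    exact_mod_cast this
  obtain ⟨ε, hε, hmix⟩ :=
    (hμ.twoPointMixture_exp (R := r) (by exact_mod_cast hr₀) hrn').exists_levelMixture
      ⌈1 / 10 ^ 7 / 4 * (n : ℝ) / (r : ℝ)⌉₊
  have hε' : ε ≤ Real.exp (-(1 / 10 ^ 7 / 2) * (n : ℝ) / (r : ℝ)) := by
    refine hε.trans ?_
    set x : ℝ := 1 / 10 ^ 7 / 4 * (n : ℝ) / (r : ℝ) with hx
    have hx1 : 1 ≤ x := by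
      rw [hx, one_le_div hr0]
      exact hrn
    have hs : ((⌈x⌉₊ : ℕ) : ℝ) ≤ 2 * x := by
      linarith [Nat.ceil_lt_add_one (zero_le_one.trans hx1)]
    have h2 : (2 : ℝ) ^ ⌈x⌉₊ ≤ Real.exp (2 * x) := by
      calc (2 : ℝ) ^ ⌈x⌉₊ ≤ Real.exp 1 ^ ⌈x⌉₊ := by
            gcongr
            linarith [Real.add_one_le_exp 1]
        _ = Real.exp ⌈x⌉₊ := Real.exp_one_pow _
        _ ≤ _ := by gcongr
    calc _ ≤ Real.exp (2 * x) * Real.exp (-(1 / 10 ^ 7 * ((n : ℝ) / r)) - 1 / 1024) := by gcongr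
      _ ≤ _ := by
        rw [← Real.exp_add]
        gcongr
        rw [show -(1 / 10 ^ 7 / 2) * (n : ℝ) / r = -(2 * x) by rw [hx]; ring,
          show 1 / 10 ^ 7 * ((n : ℝ) / r) = 4 * x by rw [hx]; ring]
        linarith
  obtain ⟨Ω, mΩ, P, h1, F, hF, Q, A, B, E, κ, h2, h3, h4, h5, h6, h7, h8, h9⟩ :=
    exists_realization hmix
  exact ⟨Ω, mΩ, P, h1, F, hF, Q, A, B, E, κ, h2, h3, h4, h5, h6, h7,
    (tsub_le_tsub_left (ENNReal.ofReal_le_ofReal hε') 1).trans h8, h9⟩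
end

section
/- There is a constant c > 0, depending only on c_1, such that for every random variable Y whose law lies in 𝒟_1 and every α ∈ [−1, 1], the tilted random variable Y^(α) satisfies Var Y^(α) ≥ c. -/
open MeasureTheory ProbabilityTheory

/-- Tilting by a function bounded by `B` decreases the variance by a factor at most
`exp (2 * B)`. -/
theorem exp_neg_mul_variance_le_variance_tilted {Ω : Type*} [MeasurableSpace Ω] {μ : Measure Ω}
    [IsProbabilityMeasure μ] {X f : Ω → ℝ} {B : ℝ} (hX : MemLp X 2 μ) (hf : AEMeasurable f μ)
    (hB : ∀ᵐ ω ∂μ, |f ω| ≤ B) :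
    Real.exp (-(2 * B)) * variance X μ ≤ variance X (μ.tilted f) := by
  have hexp : ∀ᵐ ω ∂μ, ‖Real.exp (f ω)‖ ≤ Real.exp B := by
    filter_upwards [hB] with ω hω
    rw [Real.norm_of_nonneg (Real.exp_pos _).le]
    exact Real.exp_le_exp.2 (abs_le.1 hω).2
  have hmeas : AEStronglyMeasurable (fun ω => Real.exp (f ω)) μ := hf.exp.aestronglyMeasurable
  have hint : Integrable (fun ω => Real.exp (f ω)) μ := .of_bound hmeas _ hexp
  have hZpos : 0 < ∫ ω, Real.exp (f ω) ∂μ := integral_exp_pos hint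
  have hZ : ∫ ω, Real.exp (f ω) ∂μ ≤ Real.exp B := by
    have h := norm_integral_le_of_norm_le_const hexp
    rw [Real.norm_of_nonneg hZpos.le] at h
    simpa using h
  rw [variance_eq_integral (hX.aemeasurable.mono_ac (tilted_absolutelyContinuous μ f)),
    integral_tilted]
  set m := ∫ ω, X ω ∂μ.tilted f
  have hXm : MemLp (fun ω => X ω - m) 2 μ := hX.sub (memLp_const m)
  have hsq : Integrable (fun ω => (X ω - m) ^ 2) μ := hXm.integrable_sq
  calc Real.exp (-(2 * B)) * variance X μ
      = Real.exp (-(2 * B)) * variance (fun ω => X ω - m) μ := by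
        rw [variance_sub_const hX.aestronglyMeasurable]
    _ ≤ Real.exp (-(2 * B)) * ∫ ω, (X ω - m) ^ 2 ∂μ := by
        gcongr
        exact variance_le_expectation_sq hXm.aestronglyMeasurable
    _ = ∫ ω, Real.exp (-(2 * B)) * (X ω - m) ^ 2 ∂μ := (integral_const_mul _ _).symm
    _ ≤ _ := by
        refine integral_mono_ae (hsq.const_mul _) ?_ ?_
        · simp only [smul_eq_mul, div_mul_eq_mul_div]
          exact (hsq.bdd_mul hmeas hexp).div_const _
        · filter_upwards [hB] with ω hω
          rw [smul_eq_mul]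
          gcongr
          calc Real.exp (-(2 * B)) = Real.exp (-B) / Real.exp B := by
                rw [← Real.exp_sub]; ring_nf
            _ ≤ _ := by
                gcongr
                exact (abs_le.1 hω).1

/-- **Variance of tilted laws in `𝒟₁` is bounded below.**  There is a constant `c > 0`,
depending only on `c₁`, such that for any `Y` with law in `𝒟₁` and any `α ∈ [−1, 1]`, the
exponentially tilted variable `Y^(α)` satisfies `Var Y^(α) ≥ c`. -/
theorem tilted_variance_lower_bound (c₁ : ℝ) (hc₁ : 0 < c₁) :
    ∃ c : ℝ, 0 < c ∧
      ∀ ν : Measure ℝ, MemD c₁ 1 ν →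
        ∀ α ∈ Set.Icc (-1 : ℝ) 1,
          c ≤ variance (fun x => x) (ν.tilted (fun x => α * x)) := by
  refine ⟨Real.exp (-(2 * 4)) * (c₁ * (1 / 2) ^ 2), by positivity, ?_⟩
  rintro ν ⟨_, -, hbd, hvar⟩ α hα
  have hX : MemLp (fun x : ℝ => x) 2 ν :=
    .of_bound measurable_id.aestronglyMeasurable (4 * 1) hbd
  refine (mul_le_mul_of_nonneg_left hvar (Real.exp_pos _).le).trans
    (exp_neg_mul_variance_le_variance_tilted hX (by fun_prop) ?_)
  filter_upwards [hbd] with x hx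
  rw [abs_mul]
  nlinarith [abs_le.2 hα, abs_nonneg x]
end

section
/- Let Y be a real random variable that is bounded almost surely. Then the function α ↦ E Y^(α) is differentiable on ℝ and its derivative at each α equals Var Y^(α); in particular there is a constant c > 0, depending only on c_1, such that if the law of Y lies in 𝒟_1 then (d/dα) E Y^(α) ≥ c for every α ∈ [−1, 1]. -/
open MeasureTheory ProbabilityTheory

section BoundedVariables

open Real

variable {Ω : Type*} {mΩ : MeasurableSpace Ω} {μ : Measure Ω} {X : Ω → ℝ} {M : ℝ}

lemma abs_mul_le_of_ae_abs_le (hM : ∀ᵐ ω ∂μ, |X ω| ≤ M) (t : ℝ) :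
    ∀ᵐ ω ∂μ, |t * X ω| ≤ |t| * M := by
  filter_upwards [hM] with ω hω
  rw [abs_mul]
  gcongr

lemma integrable_exp_mul_of_ae_abs_le [IsFiniteMeasure μ] (hX : AEMeasurable X μ)
    (hM : ∀ᵐ ω ∂μ, |X ω| ≤ M) (t : ℝ) : Integrable (fun ω => exp (t * X ω)) μ := by
  refine Integrable.of_bound (hX.const_mul t).exp.aestronglyMeasurable (exp (|t| * M)) ?_
  filter_upwards [abs_mul_le_of_ae_abs_le hM t] with ω hω
  rw [norm_of_nonneg (exp_pos _).le, exp_le_exp]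
  exact (abs_le.1 hω).2

lemma integrableExpSet_eq_univ_of_ae_abs_le [IsFiniteMeasure μ] (hX : AEMeasurable X μ)
    (hM : ∀ᵐ ω ∂μ, |X ω| ≤ M) : integrableExpSet X μ = Set.univ :=
  Set.eq_univ_of_forall fun t => integrable_exp_mul_of_ae_abs_le hX hM t

/-- The tilted mean is the derivative of the cumulant-generating function, and the tilted variance
is its second derivative. -/
lemma hasDerivAt_integral_tilted_mul [IsFiniteMeasure μ] (hX : AEMeasurable X μ)
    (hM : ∀ᵐ ω ∂μ, |X ω| ≤ M) (t : ℝ) :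
    HasDerivAt (fun a => ∫ ω, X ω ∂(μ.tilted (fun ω => a * X ω)))
      (variance X (μ.tilted (fun ω => t * X ω))) t := by
  have hmem (s : ℝ) : s ∈ interior (integrableExpSet X μ) := by
    simp [integrableExpSet_eq_univ_of_ae_abs_le hX hM]
  have hmean : (fun a => ∫ ω, X ω ∂(μ.tilted (fun ω => a * X ω))) = deriv (cgf X μ) :=
    funext fun a => integral_tilted_mul_self (hmem a)
  rw [hmean, variance_tilted_mul (hmem t), iteratedDeriv_succ, iteratedDeriv_one]
  exact (analyticAt_cgf (hmem t)).deriv.differentiableAt.hasDerivAt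

lemma variance_le_integral_sub_sq [IsProbabilityMeasure μ] (hX : AEStronglyMeasurable X μ)
    (a : ℝ) : variance X μ ≤ ∫ ω, (X ω - a) ^ 2 ∂μ := by
  rw [← variance_sub_const hX a]
  exact variance_le_expectation_sq (hX.sub aestronglyMeasurable_const)

/-- Exponential tilting of a bounded variable decreases its variance by at most a factor depending
on the bound and on the tilting parameter. -/
lemma exp_mul_variance_le_variance_tilted [IsProbabilityMeasure μ] (hX : AEMeasurable X μ)
    (hM : ∀ᵐ ω ∂μ, |X ω| ≤ M) (t : ℝ) :
    exp (-(2 * (|t| * M))) * variance X μ ≤ variance X (μ.tilted (fun ω => t * X ω)) := by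
  have hint := integrable_exp_mul_of_ae_abs_le hX hM t
  have hpos : 0 < mgf X μ t := mgf_pos hint
  have hmgf : mgf X μ t ≤ exp (|t| * M) := by
    have h := integral_mono_ae hint (integrable_const (exp (|t| * M))) <| by
      filter_upwards [abs_mul_le_of_ae_abs_le hM t] with ω hω
      exact exp_le_exp.2 (abs_le.1 hω).2
    simpa [mgf] using h
  rw [variance_eq_integral (hX.mono_ac (tilted_absolutelyContinuous _ _))]
  set m := ∫ ω, X ω ∂(μ.tilted (fun ω => t * X ω))
  rw [integral_tilted_mul_eq_mgf]
  have hsq : Integrable (fun ω => (X ω - m) ^ 2) μ :=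
    ((MemLp.of_bound hX.aestronglyMeasurable M hM).sub (memLp_const m)).integrable_sq
  calc exp (-(2 * (|t| * M))) * variance X μ
      ≤ exp (-(2 * (|t| * M))) * ∫ ω, (X ω - m) ^ 2 ∂μ := by
        gcongr
        exact variance_le_integral_sub_sq hX.aestronglyMeasurable m
    _ = ∫ ω, exp (-(2 * (|t| * M))) * (X ω - m) ^ 2 ∂μ := (integral_const_mul _ _).symm
    _ ≤ ∫ ω, (exp (t * X ω) / mgf X μ t) • (X ω - m) ^ 2 ∂μ := by
        refine integral_mono_ae (hsq.const_mul _) ?_ ?_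
        · refine hsq.bdd_mul (c := exp (|t| * M) / mgf X μ t)
            ((hX.const_mul t).exp.div_const _).aestronglyMeasurable ?_
          filter_upwards [abs_mul_le_of_ae_abs_le hM t] with ω hω
          rw [norm_of_nonneg (by positivity)]
          exact div_le_div_of_nonneg_right (exp_le_exp.2 (abs_le.1 hω).2) hpos.le
        · filter_upwards [abs_mul_le_of_ae_abs_le hM t] with ω hω
          rw [smul_eq_mul]
          gcongr
          rw [le_div_iff₀ hpos]
          calc exp (-(2 * (|t| * M))) * mgf X μ t
              ≤ exp (-(2 * (|t| * M))) * exp (|t| * M) := by gcongr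
            _ = exp (-(|t| * M)) := by rw [← exp_add]; ring_nf
            _ ≤ exp (t * X ω) := exp_le_exp.2 (abs_le.1 hω).1

end BoundedVariables

/-- **Derivative of the tilted mean.**  For a bounded random variable `Y`, the mean of the
exponentially tilted variable `Y^(α)` is differentiable in `α` with derivative `Var Y^(α)`;
in particular there is `c > 0`, depending only on `c₁`, such that if the law of `Y` lies in
`𝒟₁` then this derivative is at least `c` for `α ∈ [−1, 1]`. -/
theorem tilted_mean_hasDerivAt (c₁ : ℝ) (hc₁ : 0 < c₁) :
    ∃ c : ℝ, 0 < c ∧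
      ∀ {Ω : Type} [MeasurableSpace Ω] (P : Measure Ω) [IsProbabilityMeasure P]
        (Y : Ω → ℝ), Measurable Y → (∃ M : ℝ, ∀ᵐ ω ∂P, |Y ω| ≤ M) →
        (∀ α : ℝ,
          HasDerivAt (fun a : ℝ => ∫ x, x ∂((P.map Y).tilted (fun x => a * x)))
            (variance (fun x => x) ((P.map Y).tilted (fun x => α * x))) α) ∧
        (MemD c₁ 1 (P.map Y) →
          ∀ α ∈ Set.Icc (-1 : ℝ) 1,
            c ≤ deriv (fun a : ℝ => ∫ x, x ∂((P.map Y).tilted (fun x => a * x))) α) := by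
  refine ⟨Real.exp (-8) * (c₁ * (1 / 2) ^ 2), by positivity, ?_⟩
  intro Ω _ P _ Y hY ⟨M, hM⟩
  have : IsProbabilityMeasure (P.map Y) := Measure.isProbabilityMeasure_map hY.aemeasurable
  have hbdd : ∀ᵐ x ∂(P.map Y), |x| ≤ M :=
    (ae_map_iff hY.aemeasurable (measurableSet_le measurable_abs measurable_const)).2 hM
  have hderiv := hasDerivAt_integral_tilted_mul aemeasurable_id' hbdd
  refine ⟨hderiv, fun ⟨_, _, hbdd₄, hvar⟩ α hα => ?_⟩
  rw [(hderiv α).deriv]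
  have hα' : |α| ≤ 1 := abs_le.2 hα
  calc Real.exp (-8) * (c₁ * (1 / 2) ^ 2)
      ≤ Real.exp (-(2 * (|α| * (4 * 1)))) * variance (fun x => x) (P.map Y) := by
        gcongr
        linarith
    _ ≤ _ := exp_mul_variance_le_variance_tilted aemeasurable_id' hbdd₄ α
end
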